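/- With e_n = S^n(S*)^n and E_n(g) = E_μ(g|F_n), for continuous functions g and all n ≤ m: e_n M_g e_m = M_{E_n(g)} e_m as operators on L²(μ). -/

import Mathlib

open MeasureTheory Finset

/-- The full shift space `{1,…,k}^ℕ`, modeled as `ℕ → Fin k`. -/
abbrev ShiftSpace (k : ℕ) := ℕ → Fin k

/-- The left shift `T`. -/
def shiftT {k : ℕ} (x : ShiftSpace k) : ShiftSpace k := fun n => x (n + 1)

/-- Prepending a symbol: the `k` preimages of `x` under the shift are `consS i x`. -/
def consS {k : ℕ} (i : Fin k) (x : ShiftSpace k) : ShiftSpace k :=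
  fun n => Nat.casesOn n i x

/-- The Ruelle operator `ℒ_p f (x) = ∑_{T z = x} p z · f z` on complex functions. -/
noncomputable def ruelleOp {k : ℕ} (p : ShiftSpace k → ℝ) (f : ShiftSpace k → ℂ) :
    ShiftSpace k → ℂ :=
  fun x => ∑ i : Fin k, (p (consS i x) : ℂ) * f (consS i x)

/-- The Ruelle operator on real functions. -/
noncomputable def ruelleOpR {k : ℕ} (p : ShiftSpace k → ℝ) (f : ShiftSpace k → ℝ) :
    ShiftSpace k → ℝ :=
  fun x => ∑ i : Fin k, p (consS i x) * f (consS i x)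

/-- Hölder continuity with respect to the standard ultrametric on the shift space:
`|f x - f y| ≤ C · 2^{-α n}` whenever `x` and `y` agree on the first `n` coordinates. -/
def HolderSeq {k : ℕ} (f : ShiftSpace k → ℝ) : Prop :=
  ∃ C α : ℝ, 0 < α ∧ ∀ x y : ShiftSpace k, ∀ n : ℕ,
    (∀ m < n, x m = y m) → |f x - f y| ≤ C * (2 : ℝ) ^ (-(α * n))

/-- `λ^{-[n]}(x) = ∏_{i<n} p(T^i x)`. -/
noncomputable def lamInv {k : ℕ} (p : ShiftSpace k → ℝ) (n : ℕ) (x : ShiftSpace k) : ℝ :=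
  ∏ i ∈ Finset.range n, p (shiftT^[i] x)

/-- `H^{β[n]}(x) = ∏_{i<n} H(T^i x)^β`. -/
noncomputable def hPow {k : ℕ} (H : ShiftSpace k → ℝ) (β : ℝ) (n : ℕ)
    (x : ShiftSpace k) : ℝ :=
  ∏ i ∈ Finset.range n, H (shiftT^[i] x) ^ β

/-- `Λ_n = H^{-β[n]} · λ^{[n]}`. -/
noncomputable def lambdaN {k : ℕ} (p H : ShiftSpace k → ℝ) (β : ℝ) (n : ℕ)
    (x : ShiftSpace k) : ℝ :=
  hPow H (-β) n x * (lamInv p n x)⁻¹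

/-- The Ruelle operator `ℒ_{-β log H}` on real functions. -/
noncomputable def ruelleH {k : ℕ} (H : ShiftSpace k → ℝ) (β : ℝ) (f : ShiftSpace k → ℝ) :
    ShiftSpace k → ℝ :=
  fun x => ∑ i : Fin k, H (consS i x) ^ (-β) * f (consS i x)

theorem continuous_shiftT_aux {k : ℕ} : Continuous (shiftT : ShiftSpace k → ShiftSpace k) :=
  continuous_pi fun n => continuous_apply (n + 1)

theorem measurePreserving_shiftT_aux {k : ℕ}
    (p : ShiftSpace k → ℝ)
    (hp_norm : ∀ x : ShiftSpace k, ∑ i : Fin k, p (consS i x) = 1)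
    (μ : Measure (ShiftSpace k)) [IsProbabilityMeasure μ]
    (hμ : ∀ f : ShiftSpace k → ℂ, Continuous f →
      ∫ x, ruelleOp p f x ∂μ = ∫ x, f x ∂μ) :
    MeasurePreserving (shiftT : ShiftSpace k → ShiftSpace k) μ μ := by
  have hc : Continuous (shiftT : ShiftSpace k → ShiftSpace k) := continuous_shiftT_aux
  refine ⟨hc.measurable, ?_⟩
  have : IsProbabilityMeasure (μ.map (shiftT : ShiftSpace k → ShiftSpace k)) :=
    Measure.isProbabilityMeasure_map hc.measurable.aemeasurable
  apply ext_of_forall_integral_eq_of_IsFiniteMeasure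
  intro f
  rw [integral_map hc.measurable.aemeasurable f.continuous.aestronglyMeasurable]
  have h := hμ (fun x => ((f (shiftT x) : ℝ) : ℂ))
    (Complex.continuous_ofReal.comp (f.continuous.comp hc))
  have h2 : ruelleOp p (fun x => ((f (shiftT x) : ℝ) : ℂ)) = fun x => ((f x : ℝ) : ℂ) := by
    funext x
    have h3 : ∀ i : Fin k, shiftT (consS i x) = x := fun i => rfl
    simp only [ruelleOp, h3]
    rw [← Finset.sum_mul, ← Complex.ofReal_sum, hp_norm]
    simp
  rw [h2, integral_complex_ofReal, integral_complex_ofReal] at h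
  exact_mod_cast h.symm

theorem koopman_pow_aux {k : ℕ} (μ : Measure (ShiftSpace k))
    (hT : MeasurePreserving (shiftT : ShiftSpace k → ShiftSpace k) μ μ)
    (S : Lp ℂ 2 μ →L[ℂ] Lp ℂ 2 μ)
    (hS : ∀ η : Lp ℂ 2 μ, ∀ᵐ x ∂μ, S η x = η (shiftT x)) (n : ℕ) :
    ∀ η : Lp ℂ 2 μ, ∀ᵐ x ∂μ, (S ^ n) η x = η (shiftT^[n] x) := by
  induction n with
  | zero => intro η; simp
  | succ n ih =>
    intro η
    have h1 := ih (S η)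
    have h2 := (hT.iterate n).quasiMeasurePreserving.ae (hS η)
    filter_upwards [h1, h2] with x hx1 hx2
    rw [pow_succ, mul_apply_eq_comp, hx1, hx2, Function.iterate_succ_apply']

theorem koopman_isometry_aux {k : ℕ} (μ : Measure (ShiftSpace k))
    (hT : MeasurePreserving (shiftT : ShiftSpace k → ShiftSpace k) μ μ)
    (S : Lp ℂ 2 μ →L[ℂ] Lp ℂ 2 μ)
    (hS : ∀ η : Lp ℂ 2 μ, ∀ᵐ x ∂μ, S η x = η (shiftT x)) :
    ContinuousLinearMap.adjoint S * S = 1 := by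
  ext1 η
  refine ext_inner_left ℂ fun φ => ?_
  rw [mul_apply_eq_comp, ContinuousLinearMap.adjoint_inner_right,
    one_apply_eq_self, L2.inner_def, L2.inner_def]
  have hsm : AEStronglyMeasurable (fun x => inner ℂ (φ x) (η x))
      (μ.map (shiftT : ShiftSpace k → ShiftSpace k)) := by
    rw [hT.map_eq]
    exact (L2.integrable_inner φ η).aestronglyMeasurable
  have h := integral_map hT.measurable.aemeasurable hsm
  rw [hT.map_eq] at h
  rw [h]
  refine integral_congr_ae ?_
  filter_upwards [hS φ, hS η] with x h1 h2
  rw [h1, h2]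

theorem orth_aux {k : ℕ} (μ : Measure (ShiftSpace k)) [IsProbabilityMeasure μ]
    (R : ShiftSpace k → ShiftSpace k) (hR : MeasurePreserving R μ μ)
    (g : ShiftSpace k → ℂ) (hg : Integrable g μ)
    (φ η a b u v : Lp ℂ 2 μ)
    (ha : ∀ᵐ x ∂μ, a x = φ (R x)) (hb : ∀ᵐ x ∂μ, b x = η (R x))
    (hu : ∀ᵐ x ∂μ, u x = g x * b x)
    (hv : ∀ᵐ x ∂μ, v x = (μ[g | MeasurableSpace.comap R
        (inferInstance : MeasurableSpace (ShiftSpace k))]) x * b x) :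
    inner ℂ a u = inner ℂ a v := by
  rw [L2.inner_def, L2.inner_def]
  have hle : MeasurableSpace.comap R MeasurableSpace.pi ≤
      (MeasurableSpace.pi : MeasurableSpace (ShiftSpace k)) := hR.measurable.comap_le
  set w : ShiftSpace k → ℂ := fun x => η (R x) * (starRingEnd ℂ) (φ (R x)) with hw
  have hwm : StronglyMeasurable[MeasurableSpace.comap R MeasurableSpace.pi] w := by
    have h0 : StronglyMeasurable (fun x => η x * (starRingEnd ℂ) (φ x)) :=
      (Lp.stronglyMeasurable η).mul
        (Complex.continuous_conj.comp_stronglyMeasurable (Lp.stronglyMeasurable φ))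
    exact h0.comp_measurable (comap_measurable R)
  have e1 : (fun x => inner ℂ (a x) (u x)) =ᵐ[μ] fun x => w x * g x := by
    filter_upwards [ha, hb, hu] with x h1 h2 h3
    rw [h3, h2, h1, RCLike.inner_apply]
    simp only [hw]; ring
  have e2 : (fun x => inner ℂ (a x) (v x)) =ᵐ[μ] fun x => w x * (μ[g | MeasurableSpace.comap R MeasurableSpace.pi]) x := by
    filter_upwards [ha, hb, hv] with x h1 h2 h3
    rw [h3, h2, h1, RCLike.inner_apply]
    simp only [hw]; ring
  have hint : Integrable (fun x => w x * g x) μ := (L2.integrable_inner a u).congr e1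
  have hpull := condExp_bilin_of_aestronglyMeasurable_left (ContinuousLinearMap.mul ℝ ℂ)
    (hwm.aestronglyMeasurable (μ := μ)) hint hg
  rw [integral_congr_ae e1, integral_congr_ae e2]
  exact (integral_condExp (f := fun x => w x * g x) hle).symm.trans (integral_congr_ae hpull)

theorem e_n_mult_e_m_eq_condexp_mult {k : ℕ} [NeZero k]
    (p : ShiftSpace k → ℝ) (hp_cont : Continuous p) (hp_pos : ∀ x, 0 < p x)
    (hp_norm : ∀ x : ShiftSpace k, ∑ i : Fin k, p (consS i x) = 1)
    (μ : Measure (ShiftSpace k)) [IsProbabilityMeasure μ]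
    (hμ : ∀ f : ShiftSpace k → ℂ, Continuous f →
      ∫ x, ruelleOp p f x ∂μ = ∫ x, f x ∂μ)
    (S : Lp ℂ 2 μ →L[ℂ] Lp ℂ 2 μ)
    (hS : ∀ η : Lp ℂ 2 μ, ∀ᵐ x ∂μ, S η x = η (shiftT x))
    (e : ℕ → (Lp ℂ 2 μ →L[ℂ] Lp ℂ 2 μ))
    (he : ∀ n, e n = (S ^ n) * (ContinuousLinearMap.adjoint S) ^ n)
    (g : ShiftSpace k → ℂ) (hg : Continuous g) (n m : ℕ) (hnm : n ≤ m)
    (Mg : Lp ℂ 2 μ →L[ℂ] Lp ℂ 2 μ)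
    (hMg : ∀ η : Lp ℂ 2 μ, ∀ᵐ x ∂μ, Mg η x = g x * η x)
    (ME : Lp ℂ 2 μ →L[ℂ] Lp ℂ 2 μ)
    (hME : ∀ η : Lp ℂ 2 μ, ∀ᵐ x ∂μ, ME η x =
      (μ[g | MeasurableSpace.comap (shiftT^[n])
        (inferInstance : MeasurableSpace (ShiftSpace k))]) x * η x) :
    e n * Mg * e m = ME * e m := by
  have hT := measurePreserving_shiftT_aux p hp_norm μ hμ
  have hR := hT.iterate n
  have hSS := koopman_isometry_aux μ hT S hS
  have hSn := koopman_pow_aux μ hT S hS n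
  have hpow : ∀ j : ℕ, (ContinuousLinearMap.adjoint S) ^ j * S ^ j = 1 := by
    intro j
    induction j with
    | zero => simp
    | succ j ih =>
      rw [pow_succ, pow_succ', mul_assoc, ← mul_assoc _ S, hSS, one_mul, ih]
  have hadj : (ContinuousLinearMap.adjoint S) ^ n = ContinuousLinearMap.adjoint (S ^ n) := by
    rw [← ContinuousLinearMap.star_eq_adjoint, ← ContinuousLinearMap.star_eq_adjoint, star_pow]
  have hgi : Integrable g μ := by
    obtain ⟨C, hC⟩ := isCompact_univ.exists_bound_of_continuousOn hg.continuousOn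
    exact Integrable.of_bound hg.aestronglyMeasurable C
      (Filter.Eventually.of_forall fun x => hC x (Set.mem_univ x))
  ext1 ξ
  obtain ⟨η, hη⟩ : ∃ η, e m ξ = (S ^ n) η := by
    refine ⟨(S ^ (m - n)) (((ContinuousLinearMap.adjoint S) ^ m) ξ), ?_⟩
    rw [he, mul_apply_eq_comp, ← mul_apply_eq_comp (S ^ n), ← pow_add,
      Nat.add_sub_cancel' hnm]
  rw [mul_apply_eq_comp, mul_apply_eq_comp, mul_apply_eq_comp,
    hη]
  set b := (S ^ n) η with hb
  -- the projection kills the difference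
  have h1 : ((ContinuousLinearMap.adjoint S) ^ n) (Mg b)
      = ((ContinuousLinearMap.adjoint S) ^ n) (ME b) := by
    refine ext_inner_left ℂ fun φ => ?_
    rw [hadj, ContinuousLinearMap.adjoint_inner_right, ContinuousLinearMap.adjoint_inner_right]
    exact orth_aux μ _ hR g hgi φ η _ b _ _ (hSn φ) (hSn η) (hMg b) (hME b)
  -- `ME b` is in the range of `S ^ n`
  obtain ⟨θ, hθ⟩ : ∃ θ, ME b = (S ^ n) θ := by
    obtain ⟨h, hh, hhe⟩ := (stronglyMeasurable_condExp (μ := μ) (f := g)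
      (m := MeasurableSpace.comap (shiftT^[n])
        (inferInstance : MeasurableSpace (ShiftSpace k)))).exists_eq_measurable_comp
    have hsm : StronglyMeasurable (fun x => h x * η x) :=
      hh.mul (Lp.stronglyMeasurable η)
    have hae : (ME b : ShiftSpace k → ℂ) =ᵐ[μ] (fun x => h x * η x) ∘ (shiftT^[n]) := by
      filter_upwards [hME b, hSn η] with x hx1 hx2
      rw [hx1, hhe, hb, hx2]
      rfl
    have hmem : MemLp (fun x => h x * η x) 2 μ := by
      have h3 := (memLp_map_measure_iff (p := 2) (μ := μ) (f := shiftT^[n])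
        hsm.aestronglyMeasurable hR.measurable.aemeasurable).2
        ((Lp.memLp (ME b)).ae_eq hae)
      rwa [hR.map_eq] at h3
    refine ⟨hmem.toLp _, ?_⟩
    apply Lp.ext
    have h4 := hR.quasiMeasurePreserving.ae hmem.coeFn_toLp
    filter_upwards [hae, hSn (hmem.toLp _), h4] with x hx1 hx2 hx3
    rw [hx1, hx2, hx3]
    rfl
  rw [he, mul_apply_eq_comp, h1, hθ,
    ← mul_apply_eq_comp (_ ^ n) (S ^ n), hpow, one_apply_eq_self]
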